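/- For every real number x, ∫_0^∞ sin(2πxt)/sinh(πt) dt = (1/2)·tanh(πx). -/

import Mathlib

open Real

lemma aux_exp_int {b : ℝ} (hb : 0 < b) :
    MeasureTheory.IntegrableOn (fun t : ℝ => t * Real.exp (-(b * t))) (Set.Ioi 0) ∧
    ∫ t in Set.Ioi (0:ℝ), t * Real.exp (-(b * t)) = 1 / b ^ 2 := by
  constructor
  · have := integrableOn_rpow_mul_exp_neg_mul_rpow (p := 1) (s := 1) (b := b)
      (by norm_num) (by norm_num) hb
    simpa using this
  · have := Real.integral_rpow_mul_exp_neg_mul_Ioi (a := 2) (r := b) (by norm_num) hb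
    norm_num at this
    rw [this]
    simp

lemma aux_sin_int (a : ℝ) {b : ℝ} (hb : 0 < b) :
    MeasureTheory.IntegrableOn (fun t : ℝ => Real.sin (a * t) * Real.exp (-(b * t))) (Set.Ioi 0) ∧
    ∫ t in Set.Ioi (0:ℝ), Real.sin (a * t) * Real.exp (-(b * t)) = a / (a ^ 2 + b ^ 2) := by
  have hre : ((-b : ℂ) + a * Complex.I).re < 0 := by simpa using hb
  have h1 := integrableOn_exp_mul_complex_Ioi hre 0
  have h2 := integral_exp_mul_complex_Ioi hre 0
  have e : ∀ t : ℝ, Real.sin (a * t) * Real.exp (-(b * t))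
      = RCLike.im (Complex.exp (((-b : ℂ) + a * Complex.I) * t)) := by
    intro t
    simp [Complex.exp_im, mul_comm]
  simp_rw [e]
  refine ⟨MeasureTheory.Integrable.im h1, ?_⟩
  rw [integral_im h1, h2]
  have : a ^ 2 + b ^ 2 ≠ 0 := by positivity
  simp [Complex.div_im, Complex.normSq_apply]
  field_simp
  ring

lemma aux_geom {y : ℝ} (hy : 0 < y) :
    HasSum (fun n : ℕ => 2 * Real.exp (-((2 * n + 1) * y))) (1 / Real.sinh y) := by
  have h := (hasSum_geometric_of_lt_one (r := Real.exp (-(2 * y))) (Real.exp_pos _).le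
    (by rw [Real.exp_lt_one_iff]; linarith)).mul_left (2 * Real.exp (-y))
  convert! h using 1
  · ext n
    rw [← Real.exp_nat_mul, mul_assoc, ← Real.exp_add]
    ring_nf
  · rw [Real.sinh_eq]
    have h1 : Real.exp (-(2 * y)) = Real.exp (-y) ^ 2 := by rw [← Real.exp_nat_mul]; ring_nf
    have h2 : Real.exp y = (Real.exp (-y))⁻¹ := by rw [Real.exp_neg, inv_inv]
    have h3 : Real.exp (-y) < 1 := by rw [Real.exp_lt_one_iff]; linarith
    have h4 := Real.exp_pos (-y)
    rw [h1, h2]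
    generalize Real.exp (-y) = u at *
    have h5 : 1 - u ^ 2 ≠ 0 := by nlinarith
    field_simp

lemma aux_int (x : ℝ) :
    HasSum (fun n : ℕ => 4 * x / (π * (4 * x ^ 2 + (2 * n + 1) ^ 2)))
      (∫ t in Set.Ioi (0:ℝ), Real.sin (2 * π * x * t) / Real.sinh (π * t)) := by
  have hb : ∀ n : ℕ, 0 < (2 * n + 1) * π := fun n => by positivity
  have key := MeasureTheory.hasSum_integral_of_summable_integral_norm
    (μ := MeasureTheory.volume.restrict (Set.Ioi (0:ℝ)))
    (F := fun (n : ℕ) (t : ℝ) => 2 * (Real.sin (2 * π * x * t) * Real.exp (-((2 * n + 1) * π * t))))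
    (fun n => (aux_sin_int (2 * π * x) (hb n)).1.const_mul 2) ?_
  · convert! key using 1
    · ext n
      rw [MeasureTheory.integral_const_mul, (aux_sin_int (2 * π * x) (hb n)).2]
      have := Real.pi_pos
      have h1 : 4 * x ^ 2 + (2 * (n:ℝ) + 1) ^ 2 ≠ 0 := by positivity
      have h2 : (2 * π * x) ^ 2 + ((2 * (n:ℝ) + 1) * π) ^ 2 = π ^ 2 * (4 * x ^ 2 + (2 * (n:ℝ) + 1) ^ 2) := by ring
      rw [h2]
      field_simp
      ring
    · refine MeasureTheory.setIntegral_congr_fun measurableSet_Ioi fun t ht => ?_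
      have ht' : 0 < π * t := mul_pos Real.pi_pos ht
      have := (aux_geom ht').mul_left (Real.sin (2 * π * x * t))
      rw [div_eq_mul_one_div, ← this.tsum_eq]
      congr 1
      ext n
      ring_nf
  · have hs : Summable (fun n : ℕ => 2 * |2 * π * x| / π ^ 2 * (1 / ((n:ℝ) + 1) ^ 2)) := by
      apply Summable.mul_left
      have := (summable_nat_add_iff 1).2 (Real.summable_one_div_nat_pow.2 (one_lt_two))
      simpa using this
    refine Summable.of_nonneg_of_le (fun n => MeasureTheory.integral_nonneg fun t => norm_nonneg _)
      (fun n => ?_) hs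
    have hA := aux_exp_int (hb n)
    calc _ ≤ ∫ t in Set.Ioi (0:ℝ), 2 * |2 * π * x| * (t * Real.exp (-((2 * n + 1) * π * t))) := by
          refine MeasureTheory.setIntegral_mono_on
            ((aux_sin_int (2 * π * x) (hb n)).1.const_mul 2).norm (hA.1.const_mul _)
            measurableSet_Ioi fun t ht => ?_
          have ht' : 0 < t := ht
          have h1 : |Real.sin (2 * π * x * t)| ≤ |2 * π * x| * t := by
            refine Real.abs_sin_le_abs.trans ?_
            rw [abs_mul, abs_of_pos ht']
          rw [norm_mul, norm_mul, Real.norm_eq_abs (Real.sin _), Real.norm_of_nonneg (Real.exp_pos _).le,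
            Real.norm_of_nonneg zero_le_two]
          have h2 := mul_le_mul_of_nonneg_right h1 (Real.exp_pos (-((2 * n + 1) * π * t))).le
          linarith
      _ = 2 * |2 * π * x| * (1 / ((2 * n + 1) * π) ^ 2) := by
          rw [MeasureTheory.integral_const_mul, hA.2]
      _ ≤ _ := by
          have e : 2 * |2 * π * x| / π ^ 2 * (1 / ((n:ℝ) + 1) ^ 2)
              = 2 * |2 * π * x| * (1 / (((n:ℝ) + 1) * π) ^ 2) := by
            field_simp
          rw [e]
          gcongr
          linarith [(n.cast_nonneg : (0:ℝ) ≤ n)]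

lemma aux_tanh (x : ℝ) :
    Filter.Tendsto (fun N : ℕ => ∑ n ∈ Finset.range N, 4 * x / (π * (4 * x ^ 2 + (2 * (n:ℝ) + 1) ^ 2)))
      Filter.atTop (nhds ((1 / 2) * Real.tanh (π * x))) := by
  set z : ℂ := 1 / 2 + x * Complex.I with hz
  have hzm : z ∈ Complex.integerComplement := by
    rw [Complex.mem_integerComplement_iff]
    rintro ⟨n, hn⟩
    have := congrArg Complex.re hn
    simp [hz] at this
    have h2 : (2 * n : ℝ) = 1 := by rw [this]; norm_num
    norm_cast at h2
    omega
  have h := tendsto_logDeriv_euler_cot_sub hzm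
  have hsum : ∀ N : ℕ, ∑ j ∈ Finset.range N, cotTerm z j =
      (-2 * π * Complex.I) * ((∑ n ∈ Finset.range N, 4 * x / (π * (4 * x ^ 2 + (2 * (n:ℝ) + 1) ^ 2)) : ℝ) : ℂ)
        + 1 / (z + N) - 1 / z := by
    intro N
    induction N with
    | zero => simp
    | succ N ih =>
      rw [Finset.sum_range_succ, ih, Finset.sum_range_succ]
      have h0 : z + N ≠ 0 := by simpa using Complex.integerComplement_add_ne_zero hzm N
      have h1 : z - (N + 1) ≠ 0 := by
        simpa [sub_eq_add_neg] using Complex.integerComplement_add_ne_zero hzm (-(N + 1))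
      have hp : (π : ℂ) ≠ 0 := by exact_mod_cast Real.pi_ne_zero
      have h3 : (4 * (x:ℂ) ^ 2 + (2 * (N:ℂ) + 1) ^ 2) = -4 * ((z + N) * (z - (N + 1))) := by
        rw [hz]; ring_nf; rw [Complex.I_sq]; ring
      have h4 : (-2 * π * Complex.I) * (4 * x / (π * (4 * (x:ℂ) ^ 2 + (2 * (N:ℂ) + 1) ^ 2)))
          = 1 / (z + N) + 1 / (z - (N + 1)) := by
        rw [h3]
        field_simp
        rw [hz]
        ring
      push_cast
      rw [mul_add, h4, cotTerm]
      ring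
  have ht : Filter.Tendsto (fun N : ℕ => 1 / (z + N)) Filter.atTop (nhds 0) := by
    have : Filter.Tendsto (fun N : ℕ => z + (N:ℂ)) Filter.atTop (Bornology.cobounded ℂ) := by
      rw [← tendsto_norm_atTop_iff_cobounded]
      refine Filter.tendsto_atTop_mono (f := fun N : ℕ => (N : ℝ)) (fun N => ?_) tendsto_natCast_atTop_atTop
      refine le_trans ?_ (Complex.re_le_norm _)
      simp [hz]
    simpa [Function.comp_def] using Filter.tendsto_inv₀_cobounded.comp this
  have hcot : (π : ℂ) * Complex.cot (π * z) = (-2 * π * Complex.I) * (((1 / 2) * Real.tanh (π * x) : ℝ) : ℂ) := by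
    have e : (π : ℂ) * z = (π * x : ℂ) * Complex.I + π / 2 := by rw [hz]; ring
    rw [e, Complex.cot, Complex.cos_add_pi_div_two, Complex.sin_add_pi_div_two,
      Complex.sin_mul_I, Complex.cos_mul_I]
    push_cast
    rw [Complex.tanh_eq_sinh_div_cosh]
    ring
  have hc : (-2 * π * Complex.I) ≠ 0 := by simp [Real.pi_ne_zero]
  have h5 := (((h.add_const (1 / z)).sub ht).const_mul (-2 * π * Complex.I)⁻¹)
  simp only [hsum] at h5
  rw [← Filter.tendsto_ofReal_iff]
  convert! h5 using 1
  · ext N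
    rw [eq_inv_mul_iff_mul_eq₀ hc]
    ring
  · rw [hcot, sub_add_cancel, sub_zero, inv_mul_cancel_left₀ hc]

theorem integral_sin_div_sinh (x : ℝ) :
    ∫ t in Set.Ioi (0:ℝ), Real.sin (2 * π * x * t) / Real.sinh (π * t)
      = (1 / 2) * Real.tanh (π * x) :=
  tendsto_nhds_unique (aux_int x).tendsto_sum_nat (aux_tanh x)
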